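/- arXiv:1309.7677 — 2 statements merged into one kernel-verified Lean document; each statement's English description precedes it below -/
import Mathlib

section
/- For every integer k ≥ 2, every strongly 10^4·k·log k-connected tournament is k-linked. -/
/-!
Common definitions: tournaments as irreflexive, asymmetric, total relations on a
finite vertex type; reachability/strong connectivity inside induced subtournaments;
directed paths and cycles as lists of vertices; linkedness; transitivity; domination.
All logarithms are base 2 (`Real.logb 2`).
-/

variable {V : Type*}

/-- `adj` is (the edge relation of) a tournament on `V`. -/
def IsTournament (adj : V → V → Prop) : Prop :=
  (∀ v, ¬ adj v v) ∧ (∀ u v, adj u v → ¬ adj v u) ∧ (∀ u v, u ≠ v → adj u v ∨ adj v u)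

/-- There is a directed path (possibly trivial) from `x` to `y` inside the induced
subtournament on `U`. -/
def ReachIn (adj : V → V → Prop) (U : Set V) (x y : V) : Prop :=
  Relation.ReflTransGen (fun a b => a ∈ U ∧ b ∈ U ∧ adj a b) x y

/-- The induced subtournament on `U` is strongly connected. -/
def StrConnOn (adj : V → V → Prop) (U : Set V) : Prop :=
  ∀ x ∈ U, ∀ y ∈ U, ReachIn adj U x y

/-- The induced subtournament on `U` is strongly `k`-connected: it has more than `k`
vertices and removing any fewer than `k` vertices leaves it strongly connected. -/
def StrKConnOn (adj : V → V → Prop) (k : ℕ) (U : Set V) : Prop :=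
  k < U.ncard ∧ ∀ S : Set V, S ⊆ U → S.ncard < k → StrConnOn adj (U \ S)

/-- The tournament is strongly `r`-connected for a real parameter `r`:
it has more than `r` vertices, and removal of any set of fewer than `r` vertices
leaves a strongly connected tournament. -/
def StrConnR [Fintype V] (adj : V → V → Prop) (r : ℝ) : Prop :=
  r < (Fintype.card V : ℝ) ∧ ∀ S : Set V, (S.ncard : ℝ) < r → StrConnOn adj (Set.univ \ S)

/-- A directed path, recorded as its (nonempty, duplicate-free) list of vertices,
consecutive ones joined by edges. -/
def IsPathList (adj : V → V → Prop) (p : List V) : Prop :=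
  p ≠ [] ∧ p.Nodup ∧ p.Chain' adj

/-- `p` is a directed path from `x` to `y`. -/
def PathFromTo (adj : V → V → Prop) (p : List V) (x y : V) : Prop :=
  IsPathList adj p ∧ p.head? = some x ∧ p.getLast? = some y

/-- The interior (internal vertices) of a path given as a list. -/
def Interior (p : List V) : List V := p.tail.dropLast

/-- A directed cycle, recorded as a duplicate-free list of at least 3 vertices,
consecutive ones joined by edges, and an edge from the last vertex back to the first. -/
def IsCycleList (adj : V → V → Prop) (p : List V) : Prop :=
  3 ≤ p.length ∧ p.Nodup ∧ p.Chain' adj ∧ ∀ h : p ≠ [], adj (p.getLast h) (p.head h)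

/-- A tournament is `k`-linked if it has at least `2k` vertices and any `2k` distinct
vertices `x₁,…,x_k,y₁,…,y_k` can be joined by vertex-disjoint directed paths
`Pᵢ : xᵢ → yᵢ`. -/
def KLinked [Fintype V] (adj : V → V → Prop) (k : ℕ) : Prop :=
  2 * k ≤ Fintype.card V ∧
    ∀ x y : Fin k → V, Function.Injective (Sum.elim x y) →
      ∃ P : Fin k → List V,
        (∀ i, PathFromTo adj (P i) (x i) (y i)) ∧
        ∀ i j, i ≠ j → ∀ v ∈ P i, v ∉ P j

/-- The list `l` enumerates a transitive tournament: `l[i] → l[j]` iff `i < j`. -/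
def TransList (adj : V → V → Prop) (l : List V) : Prop :=
  ∀ i j : Fin l.length, adj (l.get i) (l.get j) ↔ (i : ℕ) < (j : ℕ)

/-- The induced subtournament on `A` is transitive. -/
def IsTransSet (adj : V → V → Prop) (A : Set V) : Prop :=
  ∃ l : List V, l.Nodup ∧ (∀ x, x ∈ l ↔ x ∈ A) ∧ TransList adj l

/-- The induced subtournament on `A` is transitive with sink `v`. -/
def IsTransSetSink (adj : V → V → Prop) (A : Set V) (v : V) : Prop :=
  ∃ l : List V, l.Nodup ∧ (∀ x, x ∈ l ↔ x ∈ A) ∧ TransList adj l ∧ l.getLast? = some v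

/-- The induced subtournament on `A` is transitive with source `v`. -/
def IsTransSetSource (adj : V → V → Prop) (A : Set V) (v : V) : Prop :=
  ∃ l : List V, l.Nodup ∧ (∀ x, x ∈ l ↔ x ∈ A) ∧ TransList adj l ∧ l.head? = some v

/-- `A` out-dominates `B`: every `b ∈ B` receives an edge from some `a ∈ A`. -/
def OutDominates (adj : V → V → Prop) (A B : Set V) : Prop := ∀ b ∈ B, ∃ a ∈ A, adj a b

/-- `A` in-dominates `B`: every `b ∈ B` sends an edge to some `a ∈ A`. -/
def InDominates (adj : V → V → Prop) (A B : Set V) : Prop := ∀ b ∈ B, ∃ a ∈ A, adj b a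

/-- The list `l` enumerates a backwards-transitive path:
`l[i] → l[j]` iff `j = i + 1` or `i ≥ j + 2`. -/
def BackTransList (adj : V → V → Prop) (l : List V) : Prop :=
  ∀ i j : Fin l.length,
    adj (l.get i) (l.get j) ↔ ((j : ℕ) = (i : ℕ) + 1 ∨ (j : ℕ) + 2 ≤ (i : ℕ))

/-- The induced subtournament on `Q` is a backwards-transitive path. -/
def IsBackTransPathSet (adj : V → V → Prop) (Q : Set V) : Prop :=
  ∃ l : List V, l ≠ [] ∧ l.Nodup ∧ (∀ x, x ∈ l ↔ x ∈ Q) ∧ BackTransList adj l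

/-- The ordered pair `(x, y)` is `k`-connected in the induced subtournament on `U`:
after deleting any fewer than `k` vertices of `U` other than `x, y`,
there still is a directed path from `x` to `y`. -/
def KConnPair (adj : V → V → Prop) (U : Set V) (k : ℕ) (x y : V) : Prop :=
  ∀ S : Set V, S ⊆ U \ {x, y} → S.ncard < k → ReachIn adj (U \ S) x y

section Helpers

open Finset

theorem reach_mono {adj : V → V → Prop} {U W : Set V} (h : U ⊆ W) {x y : V}
    (hr : ReachIn adj U x y) : ReachIn adj W x y :=
  Relation.ReflTransGen.mono (fun _ _ hab => ⟨h hab.1, h hab.2.1, hab.2.2⟩) _ _ hr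

theorem reach_step {adj : V → V → Prop} {U : Set V} {x y : V} (hx : x ∈ U) (hy : y ∈ U)
    (h : adj x y) : ReachIn adj U x y := Relation.ReflTransGen.single ⟨hx, hy, h⟩

theorem reach_trans {adj : V → V → Prop} {U : Set V} {x y z : V}
    (h : ReachIn adj U x y) (h' : ReachIn adj U y z) : ReachIn adj U x z :=
  Relation.ReflTransGen.trans h h'

theorem reach_flip {adj : V → V → Prop} {U : Set V} {x y : V}
    (h : ReachIn (fun a b => adj b a) U x y) : ReachIn adj U y x := by
  induction h with
  | refl => exact Relation.ReflTransGen.refl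
  | tail _ hbc ih => exact Relation.ReflTransGen.head ⟨hbc.2.1, hbc.1, hbc.2.2⟩ ih

theorem reach_path {adj : V → V → Prop} {U : Set V} {x y : V} (hy : y ∈ U)
    (h : ReachIn adj U x y) : ∃ p, PathFromTo adj p x y ∧ ∀ v ∈ p, v ∈ U := by
  classical
  induction h using Relation.ReflTransGen.head_induction_on with
  | refl => exact ⟨[y], by simp [PathFromTo, IsPathList, List.Chain'], by simpa using hy⟩
  | @head a c hac _ ih =>
    obtain ⟨p, ⟨⟨hne, hnd, hch⟩, hh, hl⟩, hU⟩ := ih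
    by_cases hap : a ∈ p
    · obtain ⟨s, t, rfl⟩ := List.append_of_mem hap
      refine ⟨a :: t, ⟨⟨by simp, ?_, ?_⟩, by simp, ?_⟩, ?_⟩
      · exact (List.nodup_append.1 hnd).2.1
      · exact hch.right_of_append
      · rw [List.getLast?_append_of_ne_nil _ (by simp)] at hl
        exact hl
      · intro v hv; exact hU v (by simp at hv ⊢; tauto)
    · refine ⟨a :: p, ⟨⟨by simp, by simp [hap, hnd], ?_⟩, by simp, ?_⟩, ?_⟩
      · refine List.IsChain.cons hch ?_
        intro z hz
        rw [hh] at hz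
        simp at hz; subst hz; exact hac.2.2
      · rw [List.getLast?_cons, hl]; rfl
      · intro v hv
        rcases List.mem_cons.1 hv with rfl | hv
        · exact hac.1
        · exact hU v hv

open Classical in
/-- Out-degree into `D`. -/
noncomputable def od (adj : V → V → Prop) (D : Finset V) (v : V) : ℕ :=
  (D.filter (fun u => adj v u)).card

theorem flip_tournament {adj : V → V → Prop} (hT : IsTournament adj) :
    IsTournament (fun a b => adj b a) :=
  ⟨hT.1, fun u v h => hT.2.1 v u h, fun u v h => (hT.2.2 u v h).symm⟩

theorem od_add {adj : V → V → Prop} (hT : IsTournament adj) (D : Finset V) {v : V} (hv : v ∈ D) :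
    od adj D v + od (fun a b => adj b a) D v + 1 = D.card := by
  classical
  unfold od
  have h1 : D.filter (fun u => adj u v) = (D.erase v).filter (fun u => ¬ adj v u) := by
    ext u
    simp only [mem_filter, mem_erase]
    constructor
    · rintro ⟨h, h'⟩
      exact ⟨⟨fun e => hT.1 v (by rwa [e] at h'), h⟩, hT.2.1 _ _ h'⟩
    · rintro ⟨⟨h, h'⟩, h2⟩
      exact ⟨h', (hT.2.2 u v h).resolve_right h2⟩
  have h2 : D.filter (fun u => adj v u) = (D.erase v).filter (fun u => adj v u) := by
    ext u
    simp only [mem_filter, mem_erase]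
    constructor
    · rintro ⟨h, h'⟩
      exact ⟨⟨fun e => hT.1 v (by rwa [e] at h'), h⟩, h'⟩
    · rintro ⟨⟨h, h'⟩, h2⟩
      exact ⟨h', h2⟩
  have h3 := card_filter_add_card_filter_not (s := D.erase v) (fun u => adj v u)
  have h4 := card_erase_add_one hv
  rw [h1, h2]
  omega

theorem od_sum (adj : V → V → Prop) (D : Finset V) :
    ∑ v ∈ D, od adj D v = ∑ v ∈ D, od (fun a b => adj b a) D v := by
  classical
  have := sum_card_bipartiteAbove_eq_sum_card_bipartiteBelow (s := D) (t := D) adj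
  unfold od
  simpa [bipartiteAbove, bipartiteBelow] using this

theorem exists_low {adj : V → V → Prop} (hT : IsTournament adj) (D : Finset V)
    (hD : D.Nonempty) : ∃ v ∈ D, 2 * od adj D v + 1 ≤ D.card := by
  by_contra! h
  have h1 : ∑ v ∈ D, od (fun a b => adj b a) D v < ∑ v ∈ D, od adj D v := by
    apply sum_lt_sum_of_nonempty hD
    intro v hv
    have := od_add hT D hv
    have := h v hv
    omega
  rw [od_sum adj D] at h1
  omega

theorem exists_high {adj : V → V → Prop} (hT : IsTournament adj) (D : Finset V)
    (hD : D.Nonempty) : ∃ v ∈ D, D.card ≤ 2 * od adj D v + 1 := by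
  obtain ⟨v, hv, h⟩ := exists_low (flip_tournament hT) D hD
  have := od_add hT D hv
  exact ⟨v, hv, by omega⟩

theorem od_mono (adj : V → V → Prop) {D E : Finset V} (h : D ⊆ E) (v : V) :
    od adj D v ≤ od adj E v := by
  classical
  unfold od
  exact card_le_card (filter_subset_filter _ h)

open Classical in
theorem star {adj : V → V → Prop} (hT : IsTournament adj) (D F : Finset V) (x b : V)
    (hb : ∀ v ∈ D, v ∉ F → od adj D b ≤ od adj D v)
    (hxb : od adj D b ≤ od adj D x) (hxb' : x ≠ b) (hx : 5 * F.card < od adj D x) :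
    ∃ I : Finset V, I ⊆ D ∧ Disjoint I F ∧ I.card ≤ 2 ∧
      ReachIn adj (↑(I ∪ {x, b})) x b := by
  by_cases h1 : adj x b
  · exact ⟨∅, by simp, by simp, by simp, reach_step (by simp) (by simp) h1⟩
  set W := (D.filter (fun u => adj x u)) \ F with hW
  by_cases h2 : ∃ w ∈ W, adj w b
  · obtain ⟨w, hw, hwb⟩ := h2
    simp only [hW, mem_sdiff, mem_filter] at hw
    refine ⟨{w}, by simpa using hw.1.1, by simpa using hw.2, by simp, ?_⟩
    exact reach_trans (reach_step (y := w) (by simp) (by simp) hw.1.2)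
      (reach_step (by simp) (by simp) hwb)
  push Not at h2
  have hWb : W ⊆ D.filter (fun u => adj b u) := by
    intro w hw
    have hw' := hw
    simp only [hW, mem_sdiff, mem_filter] at hw'
    refine mem_filter.2 ⟨hw'.1.1, ?_⟩
    have hne : w ≠ b := by rintro rfl; exact h1 hw'.1.2
    exact (hT.2.2 w b hne).resolve_left (h2 w hw)
  have hWc : od adj D x ≤ W.card + F.card := by
    have := le_card_sdiff F (D.filter (fun u => adj x u))
    rw [← hW] at this
    change (D.filter (fun u => adj x u)).card ≤ _
    omega
  have hWb' : W.card ≤ od adj D b := card_le_card hWb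
  have hne : W.Nonempty := by
    rw [← card_pos]; omega
  obtain ⟨w, hw, hlow⟩ := exists_low hT W hne
  have hw' := hw
  simp only [hW, mem_sdiff, mem_filter] at hw'
  have hwd := hb w hw'.1.1 hw'.2
  have hex : ∃ z ∈ D.filter (fun u => adj w u), z ∉ D.filter (fun u => adj b u) ∧ z ∉ F := by
    by_contra! hcon
    have hsub : D.filter (fun u => adj w u) ⊆
        W.filter (fun u => adj w u) ∪ ((D.filter (fun u => adj b u)) \ W ∪ F) := by
      intro z hz
      by_cases hzb : z ∈ D.filter (fun u => adj b u)
      · by_cases hzW : z ∈ W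
        · have : adj w z := (mem_filter.1 hz).2
          simp [hzW, this]
        · exact mem_union_right _ (mem_union_left _ (mem_sdiff.2 ⟨hzb, hzW⟩))
      · exact mem_union_right _ (mem_union_right _ (hcon z hz hzb))
    have h3 := card_le_card hsub
    have h4 := card_union_le (W.filter (fun u => adj w u)) ((D.filter (fun u => adj b u)) \ W ∪ F)
    have h5 := card_union_le ((D.filter (fun u => adj b u)) \ W) F
    have h6 := card_sdiff_add_card_eq_card hWb
    unfold od at *
    omega
  obtain ⟨z, hz, hzb, hzF⟩ := hex
  have hz' := mem_filter.1 hz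
  have hzb' : ¬ adj b z := fun h => hzb (mem_filter.2 ⟨hz'.1, h⟩)
  have hbw : adj b w := (mem_filter.1 (hWb hw)).2
  have hzne : z ≠ b := by
    rintro rfl
    exact hT.2.1 _ _ hbw hz'.2
  have hzb2 : adj z b := (hT.2.2 z b hzne).resolve_right hzb'
  refine ⟨{w, z}, ?_, ?_, card_le_two, ?_⟩
  · intro u hu
    simp only [mem_insert, mem_singleton] at hu
    rcases hu with rfl | rfl
    · exact hw'.1.1
    · exact hz'.1
  · simp [hw'.2, hzF]
  · exact reach_trans (reach_step (y := w) (by simp) (by simp) hw'.1.2)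
      (reach_trans (reach_step (y := z) (by simp) (by simp) hz'.2)
        (reach_step (by simp) (by simp) hzb2))

open Classical in
theorem star2 [Fintype V] {adj : V → V → Prop} (hT : IsTournament adj) (c : ℕ)
    (hc : ∀ v, c ≤ od adj univ v) (F : Finset V) (x b : V) (hbF : b ∈ F)
    (hb : ∀ v, v ∉ F → od adj univ b ≤ od adj univ v)
    (hx : 5 * F.card < c) :
    ∃ I : Finset V, Disjoint I F ∧ I.card ≤ 3 ∧ ReachIn adj (↑(I ∪ {x, b})) x b := by
  have h1 : ∃ w ∈ univ.filter (fun u => adj x u), w ∉ F := by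
    by_contra! hcon
    have h2 := card_le_card (show univ.filter (fun u => adj x u) ⊆ F from hcon)
    have h3 := hc x
    unfold od at h3
    omega
  obtain ⟨w, hw, hwF⟩ := h1
  have hxw : adj x w := by simpa using hw
  obtain ⟨I, -, hIF, hI, hr⟩ := star hT univ F w b (fun v _ => hb v) (hb w hwF)
    (by rintro rfl; exact hwF hbF) (lt_of_lt_of_le hx (hc w))
  refine ⟨insert w I, ?_, ?_, ?_⟩
  · simp [hwF, hIF]
  · have := card_insert_le w I; omega
  · refine reach_trans (reach_step (y := w) (by simp) (by simp) hxw) (reach_mono ?_ hr)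
    intro u hu
    simp only [coe_union, coe_insert, coe_singleton, Set.mem_union, Set.mem_insert_iff,
      Set.mem_singleton_iff, mem_coe] at hu ⊢
    tauto

theorem lowest (d : V → ℕ) (M : ℕ) (U : Finset V) (h : M ≤ U.card) :
    ∃ D ⊆ U, D.card = M ∧ ∀ u ∈ D, ∀ v ∈ U, v ∉ D → d u ≤ d v := by
  classical
  induction M with
  | zero => exact ⟨∅, by simp, by simp, by simp⟩
  | succ M ih =>
    obtain ⟨D, hDU, hDc, hD⟩ := ih (by omega)
    have hne : (U \ D).Nonempty := by
      rw [← card_pos, card_sdiff_of_subset hDU]; omega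
    obtain ⟨m, hm, hmin⟩ := exists_min_image (U \ D) d hne
    rw [mem_sdiff] at hm
    refine ⟨insert m D, insert_subset hm.1 hDU, by rw [card_insert_of_notMem hm.2, hDc], ?_⟩
    intro u hu v hv hvD
    rw [mem_insert, not_or] at hvD
    rcases mem_insert.1 hu with rfl | hu
    · exact hmin v (mem_sdiff.2 ⟨hv, hvD.2⟩)
    · exact hD u hu v hv hvD.2

open Classical in
theorem greedy {ι : Type*} (s : Finset ι) (P : ι → Finset V → Prop) (d : ℕ) (F0 : Finset V)
    (h : ∀ i ∈ s, ∀ F, F0 ⊆ F → F.card ≤ F0.card + d * s.card →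
      ∃ I : Finset V, Disjoint I F ∧ I.card ≤ d ∧ P i I) :
    ∃ I : ι → Finset V, (∀ i ∈ s, Disjoint (I i) F0 ∧ (I i).card ≤ d ∧ P i (I i)) ∧
      ∀ i ∈ s, ∀ j ∈ s, i ≠ j → Disjoint (I i) (I j) := by
  induction s using Finset.induction_on with
  | empty => exact ⟨fun _ => ∅, by simp, by simp⟩
  | insert a s ha ih =>
    rw [card_insert_of_notMem ha] at h
    obtain ⟨I, hI, hdis⟩ := ih (fun i hi F hF hFc =>
      h i (mem_insert_of_mem hi) F hF (hFc.trans (by gcongr; omega)))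
    obtain ⟨J, hJF, hJc, hJP⟩ := h a (mem_insert_self _ _) (F0 ∪ s.biUnion I) subset_union_left (by
      have h1 := card_union_le F0 (s.biUnion I)
      have h2 := card_biUnion_le_card_mul s I d (fun i hi => (hI i hi).2.1)
      have h3 : s.card * d ≤ d * (s.card + 1) := by nlinarith
      omega)
    rw [disjoint_union_right, disjoint_biUnion_right] at hJF
    have hne : ∀ i ∈ s, i ≠ a := fun i hi e => ha (e ▸ hi)
    refine ⟨Function.update I a J, ?_, ?_⟩
    · intro i hi
      rcases mem_insert.1 hi with rfl | hi
      · simp [hJF.1, hJc, hJP]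
      · rw [Function.update_of_ne (hne i hi)]; exact hI i hi
    · intro i hi j hj hij
      rcases mem_insert.1 hi with e | hi'
      · rcases mem_insert.1 hj with e' | hj'
        · exact absurd (e.trans e'.symm) hij
        · rw [e, Function.update_self, Function.update_of_ne (hne j hj')]; exact hJF.2 j hj'
      · rcases mem_insert.1 hj with e' | hj'
        · rw [e', Function.update_self, Function.update_of_ne (hne i hi')]
          exact (hJF.2 i hi').symm
        · rw [Function.update_of_ne (hne j hj'), Function.update_of_ne (hne i hi')]
          exact hdis i hi' j hj' hij

open Classical in
theorem menger_hall [Fintype V] {adj : V → V → Prop} (c : ℕ)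
    (hC : ∀ S U : Finset V, S.Nonempty → U.Nonempty → Disjoint S U →
      (∀ s ∈ S, ∀ u ∈ U, ¬ adj s u) → c ≤ ((S ∪ U)ᶜ).card)
    {ι : Type*} [Fintype ι] (b a : ι → V) (hb : Function.Injective b) (ha : Function.Injective a)
    (R : Finset V) (hbR : ∀ j, b j ∈ R) (haR : ∀ j, a j ∈ R)
    (hc : (Rᶜ).card + Fintype.card ι ≤ c) :
    ∃ f : {v // ¬ ∃ j, a j = v} → V, Function.Injective f ∧
      ∀ v, (¬ ∃ j, b j = f v) ∧ (f v = v.1 ∨ (v.1 ∈ R ∧ f v ∈ R ∧ adj v.1 (f v))) := by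
  let t : {v // ¬ ∃ j, a j = v} → Finset V := fun v => univ.filter (fun u =>
    (¬ ∃ j, b j = u) ∧ (u = v.1 ∨ (v.1 ∈ R ∧ u ∈ R ∧ adj v.1 u)))
  have key : ∀ s : Finset {v // ¬ ∃ j, a j = v}, s.card ≤ (s.biUnion t).card := by
    intro s
    set S : Finset V := s.map (Function.Embedding.subtype _) with hS
    have hScard : S.card = s.card := card_map _
    have hSa : ∀ v ∈ S, ¬ ∃ j, a j = v := by
      intro v hv
      simp only [hS, mem_map, Function.Embedding.subtype_apply] at hv
      obtain ⟨w, _, rfl⟩ := hv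
      exact w.2
    set S1 := S.filter (· ∈ R) with hS1
    set S2 := S.filter (· ∉ R) with hS2
    have h12 : S1.card + S2.card = S.card := card_filter_add_card_filter_not _
    set N := R.filter (fun u => u ∈ S1 ∨ ∃ v ∈ S1, adj v u) with hN
    have hS1N : S1 ⊆ N := by
      intro v hv
      exact mem_filter.2 ⟨(mem_filter.1 hv).2, Or.inl hv⟩
    have hsub : S2 ∪ (N \ univ.image b) ⊆ s.biUnion t := by
      intro u hu
      rw [mem_biUnion]
      rcases mem_union.1 hu with hu | hu
      · rw [hS2, mem_filter] at hu
        refine ⟨⟨u, hSa u hu.1⟩, ?_, ?_⟩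
        · have := hu.1
          simp only [hS, mem_map, Function.Embedding.subtype_apply] at this
          obtain ⟨w, hw, rfl⟩ := this
          exact hw
        · simp only [t, mem_filter, mem_univ, true_and]
          refine ⟨?_, Or.inl trivial⟩
          rintro ⟨j, rfl⟩
          exact hu.2 (hbR j)
      · rw [mem_sdiff, hN, mem_filter] at hu
        obtain ⟨⟨huR, hu1⟩, hub⟩ := hu
        have hub' : ¬ ∃ j, b j = u := by simpa using hub
        rcases hu1 with hu1 | ⟨v, hv, hvu⟩
        · have hu2 := (mem_filter.1 hu1).1
          refine ⟨⟨u, hSa u hu2⟩, ?_, ?_⟩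
          · simp only [hS, mem_map, Function.Embedding.subtype_apply] at hu2
            obtain ⟨w, hw, rfl⟩ := hu2
            exact hw
          · simp only [t, mem_filter, mem_univ, true_and]
            exact ⟨hub', Or.inl trivial⟩
        · have hv2 := mem_filter.1 hv
          refine ⟨⟨v, hSa v hv2.1⟩, ?_, ?_⟩
          · have := hv2.1
            simp only [hS, mem_map, Function.Embedding.subtype_apply] at this
            obtain ⟨w, hw, rfl⟩ := this
            exact hw
          · simp only [t, mem_filter, mem_univ, true_and]
            exact ⟨hub', Or.inr ⟨hv2.2, huR, hvu⟩⟩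
    have hdis : Disjoint S2 (N \ univ.image b) := by
      rw [disjoint_left]
      intro u hu hu'
      exact (mem_filter.1 hu).2 (mem_filter.1 (mem_sdiff.1 hu').1).1
    have h3 := card_le_card hsub
    rw [card_union_of_disjoint hdis] at h3
    have hib : (univ.image b).card = Fintype.card ι := by
      rw [card_image_of_injective _ hb]; rfl
    have hia : (univ.image a).card = Fintype.card ι := by
      rw [card_image_of_injective _ ha]; rfl
    suffices h4 : S1.card ≤ (N \ univ.image b).card by omega
    have h5 := le_card_sdiff (univ.image b) N
    rcases S1.eq_empty_or_nonempty with he | hne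
    · rw [he]; simp
    by_cases hNR : N = R
    · have h6 : S1 ⊆ R \ univ.image a := by
        intro v hv
        rw [mem_sdiff]
        refine ⟨(mem_filter.1 hv).2, ?_⟩
        simpa using hSa v (mem_filter.1 hv).1
      have h7 := card_le_card h6
      have h8 : univ.image a ⊆ R := by
        intro v hv; obtain ⟨j, _, rfl⟩ := mem_image.1 hv; exact haR j
      rw [card_sdiff_of_subset h8] at h7
      rw [hNR] at h5 ⊢
      omega
    · have hNsub : N ⊆ R := filter_subset _ _
      have hU : (R \ N).Nonempty := by
        rw [sdiff_nonempty]
        exact fun h => hNR (subset_antisymm hNsub h)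
      have h6 := hC S1 (R \ N) hne hU (by
        rw [disjoint_left]
        intro v hv hv'
        exact (mem_sdiff.1 hv').2 (hS1N hv)) (by
        intro v hv u hu huv
        rw [mem_sdiff] at hu
        exact hu.2 (mem_filter.2 ⟨hu.1, Or.inr ⟨v, hv, huv⟩⟩))
      have h7 : (S1 ∪ (R \ N))ᶜ ⊆ Rᶜ ∪ (N \ S1) := by
        intro v hv
        simp only [mem_compl, mem_union, mem_sdiff] at hv ⊢
        tauto
      have h8 := card_le_card h7
      have h9 := card_union_le (Rᶜ) (N \ S1)
      have h10 := card_sdiff_add_card_eq_card hS1N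
      omega
  obtain ⟨f, hf, hft⟩ := (Finset.all_card_le_biUnion_card_iff_exists_injective t).1 key
  refine ⟨f, hf, fun v => ?_⟩
  have := hft v
  simpa only [t, mem_filter, mem_univ, true_and] using this

open Classical in
theorem menger [Fintype V] {adj : V → V → Prop} (c : ℕ)
    (hC : ∀ S U : Finset V, S.Nonempty → U.Nonempty → Disjoint S U →
      (∀ s ∈ S, ∀ u ∈ U, ¬ adj s u) → c ≤ ((S ∪ U)ᶜ).card)
    {ι : Type*} [Fintype ι] (b a : ι → V) (hb : Function.Injective b) (ha : Function.Injective a)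
    (R : Finset V) (hbR : ∀ j, b j ∈ R) (haR : ∀ j, a j ∈ R)
    (hc : (Rᶜ).card + Fintype.card ι ≤ c) :
    ∃ (e : Equiv.Perm ι) (M : ι → Set V), (∀ j, M j ⊆ ↑R) ∧
      (∀ i j v, v ∈ M i → v ∈ M j → i = j) ∧
      ∀ j, b j ∈ M j ∧ a (e j) ∈ M j ∧ ReachIn adj (M j) (b j) (a (e j)) := by
  obtain ⟨f, hf, hfp⟩ := menger_hall c hC b a hb ha R hbR haR hc
  let φ : V → V := fun v => if h : ∃ j, a j = v then b h.choose else f ⟨v, h⟩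
  have hφa : ∀ v, (h : ∃ j, a j = v) → φ v = b h.choose := fun v h => by simp only [φ, dif_pos h]
  have hφn : ∀ v, (h : ¬ ∃ j, a j = v) → φ v = f ⟨v, h⟩ := fun v h => by simp only [φ, dif_neg h]
  have hinj : Function.Injective φ := by
    intro u v huv
    by_cases hu : ∃ j, a j = u <;> by_cases hv : ∃ j, a j = v
    · rw [hφa u hu, hφa v hv] at huv
      have := hb huv
      rw [← hu.choose_spec, ← hv.choose_spec, this]
    · rw [hφa u hu, hφn v hv] at huv
      exact absurd ⟨_, huv⟩ (hfp _).1
    · rw [hφn u hu, hφa v hv] at huv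
      exact absurd ⟨_, huv.symm⟩ (hfp _).1
    · rw [hφn u hu, hφn v hv] at huv
      exact congrArg Subtype.val (hf huv)
  have hback : ∀ v j, φ v = b j → ∃ i, a i = v := by
    intro v j h
    by_contra hv
    rw [hφn v hv] at h
    exact (hfp _).1 ⟨j, h.symm⟩
  have hex : ∀ j, ∃ n, ∃ i, a i = φ^[n] (b j) := by
    intro j
    have hp : b j ∈ Function.periodicPts φ := hinj.mem_periodicPts _
    obtain ⟨n, hn, hper⟩ := hp
    obtain ⟨m, rfl⟩ : ∃ m, n = m + 1 := ⟨n - 1, by omega⟩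
    refine ⟨m, hback _ j ?_⟩
    rw [← Function.iterate_succ_apply' φ m (b j)]
    exact hper
  let N : ι → ℕ := fun j => Nat.find (hex j)
  have hN : ∀ j, ∃ i, a i = φ^[N j] (b j) := fun j => Nat.find_spec (hex j)
  have hNmin : ∀ j m, m < N j → ¬ ∃ i, a i = φ^[m] (b j) := fun j m hm => Nat.find_min (hex j) hm
  choose e he using hN
  let M : ι → Set V := fun j => {v | ∃ m ≤ N j, φ^[m] (b j) = v}
  have hdis0 : ∀ i j m n, m ≤ n → n ≤ N j → φ^[m] (b i) = φ^[n] (b j) → i = j := by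
    intro i j m n hmn hn h
    obtain ⟨d, rfl⟩ := Nat.exists_eq_add_of_le hmn
    rw [Function.iterate_add_apply] at h
    have h1 := hinj.iterate m h
    rcases d with _ | d
    · exact hb h1
    · rw [Function.iterate_succ_apply'] at h1
      exact absurd (hback _ i h1.symm) (hNmin j d (by omega))
  have hdis : ∀ i j v, v ∈ M i → v ∈ M j → i = j := by
    rintro i j v ⟨m, hm, rfl⟩ ⟨n, hn, h⟩
    rcases le_total m n with hmn | hmn
    · exact hdis0 i j m n hmn hn h.symm
    · exact (hdis0 j i n m hmn hm h).symm
  have heM : ∀ j, a (e j) ∈ M j := fun j => ⟨N j, le_rfl, (he j).symm⟩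
  have heinj : Function.Injective e := by
    intro i j hij
    refine hdis i j _ (heM i) ?_
    rw [hij]; exact heM j
  refine ⟨Equiv.ofBijective e (Finite.injective_iff_bijective.1 heinj), M, ?_, hdis, ?_⟩
  · rintro j v ⟨m, hm, rfl⟩
    induction m with
    | zero => exact hbR j
    | succ m ih =>
      have h1 := ih (by omega)
      rw [Function.iterate_succ_apply', hφn _ (hNmin j m (by omega))]
      rcases (hfp ⟨_, hNmin j m (by omega)⟩).2 with h2 | h2
      · rw [h2]; exact h1
      · exact h2.2.1
  · intro j
    refine ⟨⟨0, Nat.zero_le _, rfl⟩, heM j, ?_⟩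
    have : ∀ m ≤ N j, ReachIn adj (M j) (b j) (φ^[m] (b j)) := by
      intro m hm
      induction m with
      | zero => exact Relation.ReflTransGen.refl
      | succ m ih =>
        refine reach_trans (ih (by omega)) ?_
        have hm1 : φ^[m] (b j) ∈ M j := ⟨m, by omega, rfl⟩
        have hm2 : φ^[m+1] (b j) ∈ M j := ⟨m + 1, hm, rfl⟩
        rw [Function.iterate_succ_apply', hφn _ (hNmin j m (by omega))] at hm2 ⊢
        rcases (hfp ⟨_, hNmin j m (by omega)⟩).2 with h2 | h2
        · rw [h2]; exact Relation.ReflTransGen.refl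
        · exact reach_step hm1 hm2 h2.2.2
    have h1 := this (N j) le_rfl
    rw [← he j] at h1
    exact h1

open Classical in
theorem pairing {k : ℕ} (e : Equiv.Perm (Fin k × Bool)) :
    ∃ g h : Fin k → Bool, ∀ i j, e (i, g i) ≠ (j, h j) := by
  let t : Fin k ⊕ Fin k → Finset (Fin k × Bool) := fun z => match z with
    | Sum.inl i => {i} ×ˢ univ
    | Sum.inr i => ({i} ×ˢ univ).map e.symm.toEmbedding
  have key : ∀ s : Finset (Fin k ⊕ Fin k), s.card ≤ (s.biUnion t).card := by
    intro s
    have h1 : s.toLeft ×ˢ (univ : Finset Bool) ⊆ s.biUnion t := by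
      rintro ⟨i, x⟩ hi
      rw [mem_biUnion]
      refine ⟨Sum.inl i, by simpa using hi, by simp [t]⟩
    have h2 : (s.toRight ×ˢ (univ : Finset Bool)).map e.symm.toEmbedding ⊆ s.biUnion t := by
      intro z hz
      obtain ⟨⟨i, x⟩, hi, rfl⟩ := mem_map.1 hz
      rw [mem_biUnion]
      refine ⟨Sum.inr i, by simpa using hi, by simp [t]⟩
    have h3 := card_le_card h1
    have h4 := card_le_card h2
    rw [card_map] at h4
    rw [card_product] at h3 h4
    have h5 : s.toLeft.card + s.toRight.card = s.card := card_toLeft_add_card_toRight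
    simp only [card_univ, Fintype.card_bool] at h3 h4
    omega
  obtain ⟨f, hf, hft⟩ := (Finset.all_card_le_biUnion_card_iff_exists_injective t).1 key
  refine ⟨fun i => (f (Sum.inl i)).2, fun i => (e (f (Sum.inr i))).2, ?_⟩
  intro i j h
  have h1 := hft (Sum.inl i)
  have h2 := hft (Sum.inr j)
  simp only [t, mem_map, mem_product, mem_singleton, mem_univ, and_true] at h1 h2
  obtain ⟨z, hz, hz'⟩ := h2
  have hz2 : z = e (f (Sum.inr j)) := by
    rw [← hz']; simp
  have e1 : (i, (f (Sum.inl i)).2) = f (Sum.inl i) := Prod.ext h1.symm rfl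
  have e2 : (j, (e (f (Sum.inr j))).2) = e (f (Sum.inr j)) := by
    rw [← hz2]; exact Prod.ext hz.symm rfl
  simp only [e1, e2] at h
  have := hf (e.injective h)
  simp at this

theorem conn_cut [Fintype V] {adj : V → V → Prop} (r : ℝ) (c : ℕ) (hcr : (c : ℝ) ≤ r)
    (h : StrConnR adj r) [DecidableEq V] (S U : Finset V) (hS : S.Nonempty) (hU : U.Nonempty)
    (hSU : Disjoint S U)
    (hno : ∀ s ∈ S, ∀ u ∈ U, ¬ adj s u) : c ≤ ((S ∪ U)ᶜ).card := by
  by_contra! hlt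
  obtain ⟨s, hs⟩ := hS
  obtain ⟨u, hu⟩ := hU
  have h1 := h.2 (↑((S ∪ U)ᶜ)) (by
    rw [Set.ncard_coe_finset]
    exact lt_of_lt_of_le (by exact_mod_cast hlt) hcr)
  have h2 := h1 s (by simp [hs]) u (by simp [hu])
  have h3 : ∀ v, ReachIn adj (Set.univ \ (↑((S ∪ U)ᶜ))) s v → v ∈ S := by
    intro v hv
    induction hv with
    | refl => exact hs
    | tail _ hbc ih =>
      have h4 := hbc.2.1
      simp only [coe_compl, Set.mem_sdiff, Set.mem_univ, true_and, Set.mem_compl_iff, not_not,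
        mem_coe, mem_union] at h4
      exact h4.resolve_right (fun hc => hno _ ih _ hc hbc.2.2)
  exact disjoint_left.1 hSU (h3 u h2) hu

open Classical in
theorem min_deg [Fintype V] {adj : V → V → Prop} (c : ℕ)
    (hV : c < Fintype.card V)
    (hC : ∀ S U : Finset V, S.Nonempty → U.Nonempty → Disjoint S U →
      (∀ s ∈ S, ∀ u ∈ U, ¬ adj s u) → c ≤ ((S ∪ U)ᶜ).card) (v : V) : c ≤ od adj univ v := by
  set U := (insert v (univ.filter (fun u => adj v u)))ᶜ with hU
  rcases U.eq_empty_or_nonempty with he | hne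
  · have h1 : insert v (univ.filter (fun u => adj v u)) = univ := by
      rw [hU, compl_eq_empty_iff] at he; exact he
    have h2 := card_insert_le v (univ.filter (fun u => adj v u))
    rw [h1, card_univ] at h2
    unfold od
    omega
  · have h1 := hC {v} U (by simp) hne (by simp [hU]) (by
      intro s hs u hu
      rw [mem_singleton] at hs
      subst hs
      simp [hU] at hu
      exact hu.2)
    refine h1.trans (card_le_card ?_)
    intro w hw
    simp [hU] at hw ⊢
    tauto

theorem enum_finset {J : Type*} [Fintype J] (s : Finset V) (h : s.card = Fintype.card J) :
    ∃ b : J → V, Function.Injective b ∧ ∀ j, b j ∈ s := by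
  have : Fintype.card J = Fintype.card s := by rw [Fintype.card_coe, h]
  obtain ⟨e⟩ := Fintype.card_eq.1 this
  exact ⟨fun j => (e j).1, fun i j hij => e.injective (Subtype.ext hij), fun j => (e j).2⟩

open Classical in
theorem main_link [Fintype V] {adj : V → V → Prop} (hT : IsTournament adj) (k c : ℕ) (hk : 1 ≤ k)
    (hc : 1000 * k ≤ c) (hV : c < Fintype.card V)
    (hC : ∀ S U : Finset V, S.Nonempty → U.Nonempty → Disjoint S U →
      (∀ s ∈ S, ∀ u ∈ U, ¬ adj s u) → c ≤ ((S ∪ U)ᶜ).card)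
    (x y : Fin k → V) (hxy : Function.Injective (Sum.elim x y)) :
    ∃ S : Fin k → Set V, (∀ i, y i ∈ S i ∧ ReachIn adj (S i) (x i) (y i)) ∧
      ∀ i j v, v ∈ S i → v ∈ S j → i = j := by
  have hT' := flip_tournament hT
  have hC' : ∀ S U : Finset V, S.Nonempty → U.Nonempty → Disjoint S U →
      (∀ s ∈ S, ∀ u ∈ U, ¬ adj u s) → c ≤ ((S ∪ U)ᶜ).card := by
    intro S U hS hU hSU h
    rw [union_comm]
    exact hC U S hU hS hSU.symm (fun s hs u hu => h u hu s hs)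
  have hdeg : ∀ v, c ≤ od adj univ v := min_deg c hV hC
  have hdeg' : ∀ v, c ≤ od (fun a b => adj b a) univ v := min_deg c hV hC'
  set XY : Finset V := univ.image x ∪ univ.image y with hXY
  have hXYc : XY.card ≤ 2 * k := by
    have h1 := card_union_le (univ.image x) (univ.image y)
    have h2 := card_image_le (s := univ) (f := x)
    have h3 := card_image_le (s := univ) (f := y)
    simp only [card_univ, Fintype.card_fin] at h2 h3
    rw [hXY]
    omega
  have hxXY : ∀ i, x i ∈ XY := fun i => by simp [hXY]
  have hyXY : ∀ i, y i ∈ XY := fun i => by simp [hXY]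
  -- the bottom set
  obtain ⟨D, hDU, hDc, hDlow⟩ := lowest (od adj univ) (65 * k) (XYᶜ) (by
    rw [card_compl]; omega)
  obtain ⟨B1, hB1D, hB1c, hB1low⟩ := lowest (od adj D) (2 * k) D (by omega)
  obtain ⟨A1, hA1s, hA1c⟩ : ∃ A1 ⊆ (D \ B1) \ D.filter (fun v => od adj D v ≤ 30 * k),
      A1.card = 2 * k := by
    apply exists_subset_card_eq
    have h1 := le_card_sdiff (D.filter (fun v => od adj D v ≤ 30 * k)) (D \ B1)
    rw [card_sdiff_of_subset hB1D] at h1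
    have h2 : (D.filter (fun v => od adj D v ≤ 30 * k)).card ≤ 60 * k + 1 := by
      rcases (D.filter (fun v => od adj D v ≤ 30 * k)).eq_empty_or_nonempty with he | hne
      · rw [he]; simp
      · obtain ⟨v, hv, hh⟩ := exists_high hT _ hne
        have h3 := (mem_filter.1 hv).2
        have h4 := od_mono adj (filter_subset (fun v => od adj D v ≤ 30 * k) D) v
        omega
    omega
  have hA1 : ∀ v ∈ A1, v ∈ D ∧ v ∉ B1 ∧ 30 * k < od adj D v := by
    intro v hv
    have := hA1s hv
    simp only [mem_sdiff, mem_filter, not_and, not_le] at this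
    exact ⟨this.1.1, this.1.2, this.2 this.1.1⟩
  -- the top set
  obtain ⟨A, hAU, hAc, hAlow⟩ := lowest (od (fun a b => adj b a) univ) (2 * k) ((XY ∪ D)ᶜ) (by
    have := card_union_le XY D
    rw [card_compl]; omega)
  have hJ : Fintype.card (Fin k × Bool) = 2 * k := by simp [mul_comm]
  obtain ⟨b, hbi, hbB⟩ := enum_finset (J := Fin k × Bool) B1 (hB1c.trans hJ.symm)
  obtain ⟨α, hαi, hαA⟩ := enum_finset (J := Fin k × Bool) A1 (hA1c.trans hJ.symm)
  obtain ⟨a, hai, haA⟩ := enum_finset (J := Fin k × Bool) A (hAc.trans hJ.symm)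
  set F0 := XY ∪ D ∪ A with hF0
  have hF0c : F0.card ≤ 69 * k := by
    have h1 := card_union_le XY D
    have h2 := card_union_le (XY ∪ D) A
    rw [hF0]
    omega
  let J3 := (Fin k × Bool) ⊕ ((Fin k × Bool) ⊕ (Fin k × Bool))
  let src : J3 → V := Sum.elim (fun j => x j.1) (Sum.elim a a)
  let tgt : J3 → V := Sum.elim b (Sum.elim (fun j => y j.1) α)
  have hJ3 : (univ : Finset J3).card = 6 * k := by
    rw [card_univ, Fintype.card_sum, Fintype.card_sum, hJ]; omega
  obtain ⟨I, hI, hIdis⟩ := greedy (univ : Finset J3)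
    (fun z I => ReachIn adj (↑(I ∪ {src z, tgt z})) (src z) (tgt z)) 3 F0 (by
    intro z _ F hF hFc
    rw [hJ3] at hFc
    have hF5 : 5 * F.card < c := by omega
    have hDF : D ⊆ F := fun v hv => hF (by simp [hF0, hv])
    have hlow : ∀ u ∈ D, ∀ v, v ∉ F → od adj univ u ≤ od adj univ v := by
      intro u hu v hv
      refine hDlow u hu v ?_ (fun h => hv (hDF h))
      rw [mem_compl]
      exact fun h => hv (hF (by simp [hF0, h]))
    rcases z with j | j | j
    · exact star2 hT c hdeg F (x j.1) (b j) (hDF (hB1D (hbB j))) (hlow _ (hB1D (hbB j))) hF5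
    · obtain ⟨I, h1, h2, h3⟩ := star2 hT' c hdeg' F (y j.1) (a j)
        (hF (by simp [hF0, haA j])) (by
          intro v hv
          refine hAlow _ (haA j) v ?_ (fun h => hv (hF (by simp [hF0, h])))
          rw [mem_compl]
          exact fun h => hv (hF (by rw [hF0]; exact mem_union_left _ h))) hF5
      refine ⟨I, h1, h2, ?_⟩
      have h4 := reach_flip h3
      rw [pair_comm] at h4
      exact h4
    · exact star2 hT c hdeg F (a j) (α j) (hDF (hA1 _ (hαA j)).1) (hlow _ (hA1 _ (hαA j)).1) hF5)
  set R : Finset V := (XY ∪ (D \ B1) ∪ univ.biUnion I)ᶜ with hR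
  have hIF : ∀ z v, v ∈ I z → v ∉ XY ∧ v ∉ D ∧ v ∉ A := by
    intro z v hv
    have := disjoint_left.1 (hI z (mem_univ _)).1 hv
    simp only [hF0, mem_union, not_or] at this
    exact ⟨this.1.1, this.1.2, this.2⟩
  have hDXY : ∀ v ∈ D, v ∉ XY := fun v hv => by simpa using hDU hv
  have hAXY : ∀ v ∈ A, v ∉ XY ∧ v ∉ D := fun v hv => by simpa using hAU hv
  have hRm : ∀ v, v ∈ R ↔ v ∉ XY ∧ ¬ (v ∈ D ∧ v ∉ B1) ∧ ∀ z, v ∉ I z := by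
    intro v
    simp only [hR, mem_compl, mem_union, mem_sdiff, mem_biUnion, mem_univ, true_and, not_or,
      not_exists]
    tauto
  have hRc : (Rᶜ).card ≤ 85 * k := by
    rw [hR, compl_compl]
    have h1 := card_union_le (XY ∪ (D \ B1)) (univ.biUnion I)
    have h2 := card_union_le XY (D \ B1)
    have h3 := card_biUnion_le_card_mul univ I 3 (fun z hz => (hI z hz).2.1)
    have h4 := card_le_card (sdiff_subset : D \ B1 ⊆ D)
    rw [hJ3] at h3
    omega
  obtain ⟨e, M, hMR, hMdis, hM⟩ := menger c hC b a hbi hai R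
    (fun j => (hRm _).2 ⟨hDXY _ (hB1D (hbB j)), fun h => h.2 (hbB j),
      fun z hz => (hIF z _ hz).2.1 (hB1D (hbB j))⟩)
    (fun j => (hRm _).2 ⟨(hAXY _ (haA j)).1, fun h => (hAXY _ (haA j)).2 h.1,
      fun z hz => (hIF z _ hz).2.2 (haA j)⟩) (by rw [hJ]; omega)
  obtain ⟨g, h, hgh⟩ := pairing e
  -- the linker
  obtain ⟨I4, hI4, hI4dis⟩ := greedy (univ : Finset (Fin k))
    (fun i I => I ⊆ D ∧ ReachIn adj (↑(I ∪ {α (e (i, g i)), b (e.symm (i, h i))}))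
      (α (e (i, g i))) (b (e.symm (i, h i)))) 2 (A1 ∪ B1) (by
    intro i _ F hF hFc
    have h1 := card_union_le A1 B1
    rw [card_univ, Fintype.card_fin] at hFc
    obtain ⟨p1, p2, p3⟩ := hA1 _ (hαA (e (i, g i)))
    obtain ⟨I, q1, q2, q3, q4⟩ := star hT D F (α (e (i, g i))) (b (e.symm (i, h i)))
      (fun v hv hvF => hB1low _ (hbB _) v hv (fun hh => hvF (hF (mem_union_right _ hh))))
      (hB1low _ (hbB _) _ p1 p2) (fun hh => p2 (hh ▸ hbB _)) (by omega)
    exact ⟨I, q2, q3, q1, q4⟩)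
  refine ⟨fun i => {v | v = x i ∨ v = y i ∨ v ∈ I (Sum.inl (i, g i)) ∨ v ∈ M (i, g i) ∨
    v ∈ I (Sum.inr (Sum.inr (e (i, g i)))) ∨ v = α (e (i, g i)) ∨ v ∈ I4 i ∨
    v ∈ M (e.symm (i, h i)) ∨ v ∈ I (Sum.inr (Sum.inl (i, h i)))}, ?_, ?_⟩
  · intro i
    refine ⟨by simp, ?_⟩
    have r1 := (hI (Sum.inl (i, g i)) (mem_univ _)).2.2
    have r2 := (hM (i, g i)).2.2
    have r3 := (hI (Sum.inr (Sum.inr (e (i, g i)))) (mem_univ _)).2.2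
    have r4 := (hI4 i (mem_univ _)).2.2.2
    have r5 := (hM (e.symm (i, h i))).2.2
    have r6 := (hI (Sum.inr (Sum.inl (i, h i))) (mem_univ _)).2.2
    have m1 := (hM (i, g i)).1
    have m2 := (hM (i, g i)).2.1
    have m3 := (hM (e.symm (i, h i))).1
    have m4 := (hM (e.symm (i, h i))).2.1
    rw [Equiv.apply_symm_apply] at r5 m4
    simp only [src, tgt, Sum.elim_inl, Sum.elim_inr] at r1 r3 r6
    refine reach_trans (reach_mono ?_ r1) (reach_trans (reach_mono ?_ r2)
      (reach_trans (reach_mono ?_ r3) (reach_trans (reach_mono ?_ r4)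
        (reach_trans (reach_mono ?_ r5) (reach_mono ?_ r6)))))
    all_goals
      intro v hv
      try simp only [coe_union, coe_insert, coe_singleton, Set.mem_union, Set.mem_insert_iff,
        Set.mem_singleton_iff, mem_coe] at hv
      simp only [Set.mem_ofPred_eq]
      grind
  · have hII : ∀ z z' v, v ∈ I z → v ∈ I z' → z = z' := by
      intro z z' v hz hz'
      by_contra hne
      exact disjoint_left.1 (hIdis z (mem_univ _) z' (mem_univ _) hne) hz hz'
    have h44 : ∀ z z' v, v ∈ I4 z → v ∈ I4 z' → z = z' := by
      intro z z' v hz hz'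
      by_contra hne
      exact disjoint_left.1 (hI4dis z (mem_univ _) z' (mem_univ _) hne) hz hz'
    have h4D : ∀ z v, v ∈ I4 z → v ∈ D ∧ v ∉ A1 ∧ v ∉ B1 := by
      intro z v hz
      have h1 := hI4 z (mem_univ _)
      have h2 := disjoint_left.1 h1.1 hz
      rw [mem_union, not_or] at h2
      exact ⟨h1.2.2.1 hz, h2⟩
    have hMM : ∀ j v, v ∈ M j → v ∉ XY ∧ ¬ (v ∈ D ∧ v ∉ B1) ∧ ∀ z, v ∉ I z :=
      fun j v hv => (hRm v).1 (hMR j hv)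
    have hxx : ∀ i j, x i = x j → i = j := fun i j hij => by
      have := @hxy (Sum.inl i) (Sum.inl j) hij
      simpa using this
    have hyy : ∀ i j, y i = y j → i = j := fun i j hij => by
      have := @hxy (Sum.inr i) (Sum.inr j) hij
      simpa using this
    have hxny : ∀ i j, x i ≠ y j := fun i j hij => by
      have := @hxy (Sum.inl i) (Sum.inr j) hij
      simp at this
    have hα : ∀ j, α j ∈ D ∧ α j ∉ B1 ∧ α j ∈ A1 := fun j =>
      ⟨(hA1 _ (hαA j)).1, (hA1 _ (hαA j)).2.1, hαA j⟩
    have hgg : ∀ i j, (i, g i) = (j, g j) → i = j := fun i j hij => (Prod.mk.inj hij).1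
    have hhh : ∀ i j, (i, h i) = (j, h j) → i = j := fun i j hij => (Prod.mk.inj hij).1
    have hgh' : ∀ i j, (i, g i) ≠ e.symm (j, h j) := fun i j hij => hgh i j (by rw [hij]; simp)
    have hei : ∀ u v, e u = e v → u = v := fun u v => e.injective.eq_iff.1
    have hesi : ∀ u v, e.symm u = e.symm v → u = v := fun u v => e.symm.injective.eq_iff.1
    have hαα : ∀ u v, α u = α v → u = v := fun u v huv => hαi huv
    -- reduce to typed membership
    have typ : ∀ i v, (v = x i ∨ v = y i ∨ v ∈ I (Sum.inl (i, g i)) ∨ v ∈ M (i, g i) ∨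
        v ∈ I (Sum.inr (Sum.inr (e (i, g i)))) ∨ v = α (e (i, g i)) ∨ v ∈ I4 i ∨
        v ∈ M (e.symm (i, h i)) ∨ v ∈ I (Sum.inr (Sum.inl (i, h i)))) →
        (v ∈ XY ∧ (v = x i ∨ v = y i)) ∨
        (v ∉ XY ∧ v ∈ D ∧ v ∉ B1 ∧ v ∈ A1 ∧ v = α (e (i, g i))) ∨
        (v ∉ XY ∧ v ∈ D ∧ v ∉ B1 ∧ v ∉ A1 ∧ v ∈ I4 i) ∨
        (v ∉ XY ∧ ¬ (v ∈ D ∧ v ∉ B1) ∧ (∀ z, v ∉ I z) ∧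
          (v ∈ M (i, g i) ∨ v ∈ M (e.symm (i, h i)))) ∨
        (v ∉ XY ∧ v ∉ D ∧ ∃ z, v ∈ I z ∧ (z = Sum.inl (i, g i) ∨
          z = Sum.inr (Sum.inr (e (i, g i))) ∨ z = Sum.inr (Sum.inl (i, h i)))) := by
      intro i v hv
      rcases hv with rfl | rfl | hv | hv | hv | rfl | hv | hv | hv
      · exact Or.inl ⟨hxXY i, Or.inl rfl⟩
      · exact Or.inl ⟨hyXY i, Or.inr rfl⟩
      · have := hIF _ _ hv
        exact Or.inr (Or.inr (Or.inr (Or.inr ⟨this.1, this.2.1, _, hv, Or.inl rfl⟩)))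
      · have := hMM _ _ hv
        exact Or.inr (Or.inr (Or.inr (Or.inl ⟨this.1, this.2.1, this.2.2, Or.inl hv⟩)))
      · have := hIF _ _ hv
        exact Or.inr (Or.inr (Or.inr (Or.inr ⟨this.1, this.2.1, _, hv, Or.inr (Or.inl rfl)⟩)))
      · have := hα (e (i, g i))
        exact Or.inr (Or.inl ⟨hDXY _ this.1, this.1, this.2.1, this.2.2, rfl⟩)
      · have := h4D _ _ hv
        exact Or.inr (Or.inr (Or.inl ⟨hDXY _ this.1, this.1, this.2.2, this.2.1, hv⟩))
      · have := hMM _ _ hv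
        exact Or.inr (Or.inr (Or.inr (Or.inl ⟨this.1, this.2.1, this.2.2, Or.inr hv⟩)))
      · have := hIF _ _ hv
        exact Or.inr (Or.inr (Or.inr (Or.inr ⟨this.1, this.2.1, _, hv, Or.inr (Or.inr rfl)⟩)))
    intro i j v hi hj
    rcases typ i v hi with ⟨c1, hi⟩ | ⟨c1, c2, c3, c4, hi⟩ | ⟨c1, c2, c3, c4, hi⟩ |
      ⟨c1, c2, c3, hi⟩ | ⟨c1, c2, z, hz, hi⟩ <;>
    rcases typ j v hj with ⟨d1, hj⟩ | ⟨d1, d2, d3, d4, hj⟩ | ⟨d1, d2, d3, d4, hj⟩ |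
      ⟨d1, d2, d3, hj⟩ | ⟨d1, d2, z', hz', hj⟩ <;> first
      | exact absurd c1 d1
      | exact absurd d1 c1
      | exact absurd c4 d4
      | exact absurd d4 c4
      | exact (d2 ⟨c2, c3⟩).elim
      | exact (c2 ⟨d2, d3⟩).elim
      | exact (d2 c2).elim
      | exact (c2 d2).elim
      | skip
    · rcases hi with hi | hi <;> rcases hj with hj | hj
      · exact hxx _ _ (hi.symm.trans hj)
      · exact absurd (hi.symm.trans hj) (hxny _ _)
      · exact absurd (hj.symm.trans hi) (hxny _ _)
      · exact hyy _ _ (hi.symm.trans hj)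
    · exact hgg _ _ (hei _ _ (hαα _ _ (hi.symm.trans hj)))
    · exact h44 _ _ _ hi hj
    · rcases hi with hi | hi <;> rcases hj with hj | hj
      · exact hgg _ _ (hMdis _ _ _ hi hj)
      · exact absurd (hMdis _ _ _ hi hj) (hgh' _ _)
      · exact absurd (hMdis _ _ _ hj hi) (hgh' _ _)
      · exact hhh _ _ (hesi _ _ (hMdis _ _ _ hi hj))
    · exact absurd hz' (c3 z')
    · exact absurd hz (d3 z)
    · have hzz := hII _ _ _ hz hz'
      subst hzz
      rcases hi with rfl | rfl | rfl <;> rcases hj with hj | hj | hj <;>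
        first
        | exact absurd hj Sum.inl_ne_inr
        | exact absurd hj Sum.inr_ne_inl
        | exact absurd (Sum.inr.inj hj) Sum.inl_ne_inr
        | exact absurd (Sum.inr.inj hj) Sum.inr_ne_inl
        | exact hgg _ _ (Sum.inl.inj hj)
        | exact hgg _ _ (hei _ _ (Sum.inr.inj (Sum.inr.inj hj)))
        | exact hhh _ _ (Sum.inl.inj (Sum.inr.inj hj))

end Helpers

/-- For every `k ≥ 2`, every strongly `10^4 k log k`-connected tournament
is `k`-linked. -/
theorem stmt11 [Fintype V] (adj : V → V → Prop) (hT : IsTournament adj)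
    (k : ℕ) (hk : 2 ≤ k)
    (hconn : StrConnR adj (10 ^ 4 * (k : ℝ) * Real.logb 2 (k : ℝ))) :
    KLinked adj k := by
  classical
  have hlog : (1 : ℝ) ≤ Real.logb 2 (k : ℝ) := by
    rw [Real.le_logb_iff_rpow_le (by norm_num) (by positivity)]
    simpa using (by exact_mod_cast hk : (2 : ℝ) ≤ k)
  have hr : ((1000 * k : ℕ) : ℝ) ≤ 10 ^ 4 * (k : ℝ) * Real.logb 2 (k : ℝ) := by
    have hk0 : (0 : ℝ) ≤ k := Nat.cast_nonneg k
    push_cast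
    nlinarith
  have hV : 1000 * k < Fintype.card V := by
    have := lt_of_le_of_lt hr hconn.1
    exact_mod_cast this
  refine ⟨by omega, fun x y hxy => ?_⟩
  obtain ⟨S, hS, hdis⟩ := main_link hT k (1000 * k) (by omega) le_rfl hV
    (fun S U h1 h2 h3 h4 => by
      have := conn_cut _ _ hr hconn S U h1 h2 h3 h4
      convert this) x y hxy
  choose P hP hPS using fun i => reach_path (hS i).1 (hS i).2
  refine ⟨P, hP, fun i j hij v hv hv' => hij (hdis i j v (hPS i v hv) (hPS j v hv'))⟩
end

section
/- Let T be a tournament and let k be a positive integer. Suppose A_1, …, A_k, B_1, …, B_k are pairwise disjoint subsets of V(T), and write D := A_1 ∪ … ∪ A_k ∪ B_1 ∪ … ∪ B_k. Suppose that for each i ∈ {1, …, k}: T[A_i] is a transitive tournament, T[B_i] is a transitive tournament, there are sets E_{A_i}, E_{B_i} ⊆ V(T) such that A_i out-dominates V(T) \ (D ∪ E_{A_i}) and B_i in-dominates V(T) \ (D ∪ E_{B_i}), and P_i is a directed path in T from the sink of T[B_i] to the source of T[A_i] whose interior vertices lie outside D; further suppose the paths P_1, …, P_k are pairwise vertex-disjoint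 apart from their endpoints lying in distinct sets B_i, A_i. Write E_A := E_{A_1} ∪ … ∪ E_{A_k} and E_B := E_{B_1} ∪ … ∪ E_{B_k}, and let V ⊆ V(T) be any set containing A_i ∪ B_i ∪ V(P_i) for every i ∈ {1, …, k}. Then for every pair of vertices x ∈ V(T) \ (D ∪ E_B) and y ∈ V(T) \ (D ∪ E_A), the ordered pair (x, y) is k-connected in T[V ∪ {x, y}]. -/
/-!
Common definitions: tournaments as irreflexive, asymmetric, total relations on a
finite vertex type; reachability/strong connectivity inside induced subtournaments;
directed paths and cycles as lists of vertices; linkedness; transitivity; domination.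
All logarithms are base 2 (`Real.logb 2`).
-/

variable {V : Type*}

theorem reach_chain_aux (adj : V → V → Prop) (U : Set V) (p : List V) :
    ∀ u v : V, p.IsChain adj → (∀ w ∈ p, w ∈ U) → p.head? = some u → p.getLast? = some v →
      ReachIn adj U u v := by
  induction p with
  | nil => intro u v _ _ h; simp at h
  | cons c l ih =>
    intro u v hc hU hu hv
    simp only [List.head?_cons, Option.some.injEq] at hu
    subst hu
    cases l with
    | nil =>
      simp at hv
      subst hv
      exact Relation.ReflTransGen.refl
    | cons d l =>
      rw [List.isChain_cons_cons] at hc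
      refine Relation.ReflTransGen.head ⟨hU c (by simp), hU d (by simp), hc.1⟩ ?_
      refine ih d v hc.2 (fun w hw => hU w (List.mem_cons_of_mem _ hw)) rfl ?_
      simpa using hv

theorem source_aux (adj : V → V → Prop) (A : Set V) (a : V) (h : IsTransSetSource adj A a) :
    a ∈ A ∧ ∀ c ∈ A, c = a ∨ adj a c := by
  obtain ⟨l, hn, hm, ht, hh⟩ := h
  refine ⟨(hm a).1 (List.mem_of_head? hh), fun c hc => ?_⟩
  obtain ⟨i, hi, rfl⟩ := List.getElem_of_mem ((hm c).2 hc)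
  have h0 : 0 < l.length := by omega
  have ha : l[0] = a := by
    rw [List.head?_eq_getElem?, List.getElem?_eq_getElem h0] at hh
    simpa using hh
  subst ha
  by_cases h : i = 0
  · left; subst h; rfl
  · right; exact (ht ⟨0, h0⟩ ⟨i, hi⟩).2 (Nat.pos_of_ne_zero h)

theorem sink_aux (adj : V → V → Prop) (A : Set V) (a : V) (h : IsTransSetSink adj A a) :
    a ∈ A ∧ ∀ c ∈ A, c = a ∨ adj c a := by
  obtain ⟨l, hn, hm, ht, hh⟩ := h
  refine ⟨(hm a).1 (List.mem_of_getLast? hh), fun c hc => ?_⟩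
  obtain ⟨i, hi, rfl⟩ := List.getElem_of_mem ((hm c).2 hc)
  have h0 : l.length - 1 < l.length := by omega
  have ha : l[l.length - 1] = a := by
    rw [List.getLast?_eq_getElem?, List.getElem?_eq_getElem h0] at hh
    simpa using hh
  subst ha
  by_cases h : i = l.length - 1
  · left; subst h; rfl
  · right; exact (ht ⟨i, hi⟩ ⟨l.length - 1, h0⟩).2 (by simp only; omega)

theorem mem_path_aux (p : List V) (u v : V) (hu : p.head? = some u) (hv : p.getLast? = some v)
    (w : V) (hw : w ∈ p) : w = u ∨ w = v ∨ w ∈ Interior p := by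
  cases p with
  | nil => simp at hw
  | cons c l =>
    simp only [List.head?_cons, Option.some.injEq] at hu
    subst hu
    rcases List.mem_cons.1 hw with h | h
    · exact Or.inl h
    · right
      have hne : l ≠ [] := List.ne_nil_of_mem h
      have hl : l.getLast hne = v := by
        rw [List.getLast?_cons_of_ne_nil hne, List.getLast?_eq_getLast_of_ne_nil hne] at hv
        simpa using hv
      rw [← List.dropLast_append_getLast hne, List.mem_append] at h
      rcases h with h | h
      · right; exact h
      · left; rw [← hl]; simpa using h

/-- Given pairwise disjoint sets `A₁,…,A_k, B₁,…,B_k` inducing transitive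
subtournaments (with sources `a i` of `T[Aᵢ]` and sinks `b i` of `T[Bᵢ]`), sets
`E_{Aᵢ}, E_{Bᵢ}` such that `Aᵢ` out-dominates `V(T) \ (D ∪ E_{Aᵢ})` and `Bᵢ` in-dominates
`V(T) \ (D ∪ E_{Bᵢ})` (where `D` is the union of all `Aᵢ, Bᵢ`), and pairwise vertex-disjoint
directed paths `Pᵢ` from the sink of `T[Bᵢ]` to the source of `T[Aᵢ]` with interiors outside
`D`: for any set `W` containing all `Aᵢ ∪ Bᵢ ∪ V(Pᵢ)` and any vertices `x ∉ D ∪ E_B`,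
`y ∉ D ∪ E_A`, the ordered pair `(x, y)` is `k`-connected in `T[W ∪ {x, y}]`. -/
theorem stmt12 [Fintype V] (adj : V → V → Prop) (hT : IsTournament adj)
    (k : ℕ) (hk : 1 ≤ k)
    (A B : Fin k → Set V) (a b : Fin k → V) (EA EB : Fin k → Set V)
    (P : Fin k → List V)
    (hdisj : Pairwise fun p q : Fin k ⊕ Fin k =>
      Disjoint (Sum.elim A B p) (Sum.elim A B q))
    (hA : ∀ i, IsTransSetSource adj (A i) (a i))
    (hB : ∀ i, IsTransSetSink adj (B i) (b i))
    (hout : ∀ i, OutDominates adj (A i)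
      (Set.univ \ ((⋃ j, A j ∪ B j) ∪ EA i)))
    (hin : ∀ i, InDominates adj (B i)
      (Set.univ \ ((⋃ j, A j ∪ B j) ∪ EB i)))
    (hP : ∀ i, PathFromTo adj (P i) (b i) (a i))
    (hPint : ∀ i, ∀ v ∈ Interior (P i), v ∉ (⋃ j, A j ∪ B j))
    (hPdisj : ∀ i j, i ≠ j → ∀ v ∈ P i, v ∉ P j)
    (W : Set V) (hW : ∀ i, A i ∪ B i ∪ {v | v ∈ P i} ⊆ W)
    (x y : V)
    (hx : x ∉ (⋃ j, A j ∪ B j) ∪ ⋃ j, EB j)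
    (hy : y ∉ (⋃ j, A j ∪ B j) ∪ ⋃ j, EA j) :
    KConnPair adj (W ∪ {x, y}) k x y := by
  classical
  intro S hS hcard
  have hAm := fun i => source_aux adj (A i) (a i) (hA i)
  have hBm := fun i => sink_aux adj (B i) (b i) (hB i)
  have hD : ∀ i v, v ∈ A i ∪ B i → v ∈ ⋃ j, A j ∪ B j := fun i v h => Set.mem_iUnion.2 ⟨i, h⟩
  have hAB : ∀ i j v, i ≠ j → v ∈ A i ∪ B i → v ∉ A j ∪ B j := by
    intro i j v hij h1 h2
    have key : ∀ p q : Fin k ⊕ Fin k, p ≠ q → v ∈ Sum.elim A B p → v ∉ Sum.elim A B q :=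
      fun p q hpq h h' => Set.disjoint_left.1 (hdisj hpq) h h'
    rcases h1 with h1 | h1 <;> rcases h2 with h2 | h2
    · exact key (Sum.inl i) (Sum.inl j) (by simpa using hij) h1 h2
    · exact key (Sum.inl i) (Sum.inr j) (by simp) h1 h2
    · exact key (Sum.inr i) (Sum.inl j) (by simp) h1 h2
    · exact key (Sum.inr i) (Sum.inr j) (by simpa using hij) h1 h2
  have hPD : ∀ i j v, i ≠ j → v ∈ P i → v ∉ A j ∪ B j := by
    intro i j v hij hv h
    rcases mem_path_aux (P i) _ _ (hP i).2.1 (hP i).2.2 v hv with h1 | h1 | h1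
    · subst h1; exact hAB i j _ hij (Or.inr (hBm i).1) h
    · subst h1; exact hAB i j _ hij (Or.inl (hAm i).1) h
    · exact hPint i v h1 (hD j v h)
  obtain ⟨i, hi⟩ : ∃ i, ∀ v ∈ A i ∪ B i ∪ {v | v ∈ P i}, v ∉ S := by
    by_contra hcon
    push Not at hcon
    choose s hs hsS using hcon
    have hinj : Function.Injective s := by
      intro i j hij
      by_contra hne
      have h1 := hs i
      have h2 := hs j
      rw [← hij] at h2
      rcases h1 with h1 | h1 <;> rcases h2 with h2 | h2
      · exact hAB i j _ hne h1 h2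
      · exact hPD j i _ (Ne.symm hne) h2 h1
      · exact hPD i j _ hne h1 h2
      · exact hPdisj i j hne _ h1 h2
    have h1 : (Set.range s).ncard = k := by
      rw [← Set.image_univ, Set.ncard_image_of_injective _ hinj, Set.ncard_univ, Nat.card_fin]
    have h2 := Set.ncard_le_ncard (Set.range_subset_iff.2 hsS) (Set.toFinite S)
    omega
  have hU : ∀ v ∈ A i ∪ B i ∪ {v | v ∈ P i}, v ∈ (W ∪ {x, y}) \ S :=
    fun v hv => ⟨Or.inl (hW i hv), hi v hv⟩
  have hxU : x ∈ (W ∪ {x, y}) \ S := ⟨Or.inr (by simp), fun h => (hS h).2 (by simp)⟩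
  have hyU : y ∈ (W ∪ {x, y}) \ S := ⟨Or.inr (by simp), fun h => (hS h).2 (by simp)⟩
  obtain ⟨c, hc, hxc⟩ := hin i x ⟨trivial, fun h => hx (h.imp id fun h => Set.mem_iUnion.2 ⟨i, h⟩)⟩
  obtain ⟨d, hd, hdy⟩ := hout i y ⟨trivial, fun h => hy (h.imp id fun h => Set.mem_iUnion.2 ⟨i, h⟩)⟩
  have hcU := hU c (Or.inl (Or.inr hc))
  have hdU := hU d (Or.inl (Or.inl hd))
  have hbU := hU _ (Or.inl (Or.inr (hBm i).1))
  have haU := hU _ (Or.inl (Or.inl (hAm i).1))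
  have r1 : ReachIn adj ((W ∪ {x, y}) \ S) c (b i) := by
    rcases (hBm i).2 c hc with h | h
    · rw [h]; exact Relation.ReflTransGen.refl
    · exact Relation.ReflTransGen.single ⟨hcU, hbU, h⟩
  have r2 : ReachIn adj ((W ∪ {x, y}) \ S) (a i) d := by
    rcases (hAm i).2 d hd with h | h
    · rw [h]; exact Relation.ReflTransGen.refl
    · exact Relation.ReflTransGen.single ⟨haU, hdU, h⟩
  have r3 : ReachIn adj ((W ∪ {x, y}) \ S) (b i) (a i) :=
    reach_chain_aux adj _ (P i) _ _ (hP i).1.2.2 (fun w hw => hU w (Or.inr hw))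
      (hP i).2.1 (hP i).2.2
  exact Relation.ReflTransGen.head ⟨hxU, hcU, hxc⟩
    (r1.trans (r3.trans (r2.tail ⟨hdU, hyU, hdy⟩)))
end
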